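/- Let n ≥ 1, let Ω ⊆ ℝⁿ be a bounded measurable set, let s : ℝⁿ → ℝⁿ be a C¹ vector field with bounded derivative, and let Φ_t = id + t·s. Fix constants γ₁ > 0 and V₀ ∈ ℝ, and define the volume-penalty functional J_V(t) = γ₁ · (vol(Φ_t(Ω)) − V₀)². Then J_V is differentiable at t = 0 with derivative J_V′(0) = 2 γ₁ (vol(Ω) − V₀) · ∫_Ω div s(x) dx. (This is the shape sensitivity of the quadratic volume penalty term J_V used in the Stokes drag-minimization example, expressed in volume form via the divergence theorem.) -/

import Mathlib

open MeasureTheory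

/-- The determinant is a smooth function on the endomorphisms of a finite-dimensional space. -/
lemma ContinuousLinearMap.contDiff_det {E : Type*} [NormedAddCommGroup E] [NormedSpace ℝ E]
    [FiniteDimensional ℝ E] {k : WithTop ℕ∞} :
    ContDiff ℝ k (fun A : E →L[ℝ] E => A.det) := by
  classical
  let b := Module.finBasis ℝ E
  have hdet : (fun A : E →L[ℝ] E => A.det) = fun A : E →L[ℝ] E =>
      ∑ σ : Equiv.Perm (Fin (Module.finrank ℝ E)),
        ((σ.sign : ℤ) : ℝ) * ∏ i, b.coord (σ i) (A (b i)) := by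
    funext A
    rw [ContinuousLinearMap.det, ← LinearMap.det_toMatrix b, Matrix.det_apply']
    simp [LinearMap.toMatrix_apply]
  rw [hdet]
  refine ContDiff.sum fun σ _ => contDiff_const.mul (contDiff_prod fun i _ => ?_)
  exact (((b.coord (σ i)).toContinuousLinearMap).comp
    (ContinuousLinearMap.apply ℝ E (b i))).contDiff

/-- The derivative of the determinant at the identity is the trace. -/
lemma ContinuousLinearMap.hasDerivAt_det_id_add_smul {E : Type*} [NormedAddCommGroup E]
    [NormedSpace ℝ E] [FiniteDimensional ℝ E] (A : E →L[ℝ] E) :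
    HasDerivAt (fun t : ℝ => (ContinuousLinearMap.id ℝ E + t • A).det)
      (LinearMap.trace ℝ E A.toLinearMap) 0 := by
  classical
  let b := Module.finBasis ℝ E
  let M := LinearMap.toMatrix b b A.toLinearMap
  let p := (Matrix.det (1 + (Polynomial.X : Polynomial ℝ) • M.map Polynomial.C)).divX.divX
  have hdet : (fun t : ℝ => (ContinuousLinearMap.id ℝ E + t • A).det) =
      fun t => 1 + M.trace * t + p.eval t * t ^ 2 := by
    funext t
    rw [ContinuousLinearMap.det, ← LinearMap.det_toMatrix b, ← Matrix.det_one_add_smul]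
    simp [M]
  rw [hdet, LinearMap.trace_eq_matrix_trace ℝ b]
  have h := (((hasDerivAt_id (0 : ℝ)).const_mul M.trace).const_add 1).add
    ((p.hasDerivAt 0).mul ((hasDerivAt_id (0 : ℝ)).pow 2))
  refine (h.congr_deriv ?_)
  simp [M]

/-- On a norm-bounded set of endomorphisms `A`, the functions `t ↦ |det (1 + t A)|` are uniformly
Lipschitz near `0`. -/
lemma ContinuousLinearMap.exists_lipschitzOnWith_abs_det_id_add_smul {E : Type*}
    [NormedAddCommGroup E] [NormedSpace ℝ E] [FiniteDimensional ℝ E] (C : ℝ) :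
    ∃ K : NNReal, ∀ A : E →L[ℝ] E, ‖A‖ ≤ C →
      LipschitzOnWith K (fun t : ℝ => |(ContinuousLinearMap.id ℝ E + t • A).det|)
        (Metric.closedBall 0 1) := by
  have : ProperSpace (E →L[ℝ] E) := FiniteDimensional.proper ℝ _
  have hsmooth : ContDiff ℝ 1 fun q : ℝ × (E →L[ℝ] E) =>
      (ContinuousLinearMap.id ℝ E + q.1 • q.2).det :=
    ContinuousLinearMap.contDiff_det.comp (contDiff_const.add (contDiff_fst.smul contDiff_snd))
  obtain ⟨K, hK⟩ := (hsmooth.locallyLipschitz.locallyLipschitzOn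
    (s := Metric.closedBall 0 1 ×ˢ Metric.closedBall 0 C)).exists_lipschitzOnWith_of_compact
    ((isCompact_closedBall _ _).prod (isCompact_closedBall _ _))
  refine ⟨K, fun A hA => LipschitzOnWith.of_dist_le_mul fun t ht u hu => ?_⟩
  have h := hK.dist_le_mul (t, A) ⟨ht, by simpa using hA⟩ (u, A) ⟨hu, by simpa using hA⟩
  have hdist : dist (t, A) (u, A) = dist t u := by simp [Prod.dist_eq]
  rw [hdist] at h
  exact (abs_abs_sub_abs_le_abs_sub _ _).trans h

/-- A perturbation of the identity by a small multiple of a Lipschitz map is injective. -/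
lemma LipschitzWith.injective_id_add_smul {E : Type*} [NormedAddCommGroup E] [NormedSpace ℝ E]
    {s : E → E} {K : NNReal} (hs : LipschitzWith K s) {t : ℝ} (ht : |t| * K < 1) :
    Function.Injective fun x => x + t • s x := by
  intro x y hxy
  have h : x - y = t • (s y - s x) := by
    rw [smul_sub, sub_eq_sub_iff_add_eq_add, add_comm (t • s y)]
    exact hxy
  have hle : ‖x - y‖ ≤ |t| * K * ‖x - y‖ := by
    calc ‖x - y‖ = |t| * ‖s y - s x‖ := by rw [h, norm_smul, Real.norm_eq_abs]
      _ ≤ |t| * (K * ‖y - x‖) := by gcongr; exact hs.norm_sub_le y x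
      _ = |t| * K * ‖x - y‖ := by rw [norm_sub_rev y x, mul_assoc]
  have : ‖x - y‖ = 0 := by nlinarith [norm_nonneg (x - y)]
  exact sub_eq_zero.mp (norm_eq_zero.mp this)

/-- **First variation of volume** under the perturbations of the identity `id + t • s`. -/
lemma hasDerivAt_measureReal_image_id_add_smul {E : Type*} [NormedAddCommGroup E]
    [NormedSpace ℝ E] [FiniteDimensional ℝ E] [MeasurableSpace E] [BorelSpace E]
    (μ : Measure E) [μ.IsAddHaarMeasure] {Ω : Set E} (hΩ : MeasurableSet Ω) (hΩfin : μ Ω ≠ ⊤)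
    {s : E → E} (hs : ContDiff ℝ 1 s) {C : ℝ} (hC : ∀ x, ‖fderiv ℝ s x‖ ≤ C) :
    HasDerivAt (fun t : ℝ => μ.real ((fun x => x + t • s x) '' Ω))
      (∫ x in Ω, LinearMap.trace ℝ E (fderiv ℝ s x).toLinearMap ∂μ) 0 := by
  have hdiff : Differentiable ℝ s := hs.differentiable one_ne_zero
  have hcont : Continuous (fderiv ℝ s) := hs.continuous_fderiv one_ne_zero
  have hC0 : 0 ≤ C := (norm_nonneg _).trans (hC 0)
  have hlip : LipschitzWith C.toNNReal s := lipschitzWith_of_nnnorm_fderiv_le hdiff fun x => by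
    rw [← NNReal.coe_le_coe, Real.coe_toNNReal C hC0]
    exact hC x
  have : IsFiniteMeasure (μ.restrict Ω) := ⟨by simpa using hΩfin.lt_top⟩
  obtain ⟨K, hK⟩ :=
    ContinuousLinearMap.exists_lipschitzOnWith_abs_det_id_add_smul (E := E) C
  have hchange : ∀ᶠ t : ℝ in nhds 0, μ.real ((fun x => x + t • s x) '' Ω) =
      ∫ x in Ω, |(ContinuousLinearMap.id ℝ E + t • fderiv ℝ s x).det| ∂μ := by
    have hsmall : ∀ᶠ t : ℝ in nhds 0, |t| * C.toNNReal < 1 := by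
      have : Continuous fun t : ℝ => |t| * (C.toNNReal : ℝ) := by fun_prop
      exact this.continuousAt.eventually_lt continuousAt_const (by simp)
    filter_upwards [hsmall] with t ht
    have h := integral_image_eq_integral_abs_det_fderiv_smul μ hΩ
      (fun x _ => ((hasFDerivAt_id x).add
        ((hdiff x).hasFDerivAt.const_smul t)).hasFDerivWithinAt)
      (hlip.injective_id_add_smul ht).injOn (fun _ => (1 : ℝ))
    simpa using! h
  have hdet : ∀ t : ℝ, Continuous fun x =>
      |(ContinuousLinearMap.id ℝ E + t • fderiv ℝ s x).det| := fun t =>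
    ((ContinuousLinearMap.contDiff_det (k := 0)).continuous.comp (by fun_prop)).abs
  have htrace : Continuous fun x => LinearMap.trace ℝ E (fderiv ℝ s x).toLinearMap :=
    ((LinearMap.trace ℝ E ∘ₗ ContinuousLinearMap.coeLM ℝ).continuous_of_finiteDimensional).comp
      hcont
  refine HasDerivAt.congr_of_eventuallyEq ?_ hchange
  refine (hasDerivAt_integral_of_dominated_loc_of_lip (bound := fun _ => (K : ℝ))
    (Metric.closedBall_mem_nhds 0 one_pos)
    (.of_forall fun t => (hdet t).aestronglyMeasurable) ?_ htrace.aestronglyMeasurable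
    (.of_forall fun x => ?_) (integrable_const _) (.of_forall fun x => ?_)).2
  · simp [ContinuousLinearMap.det]
  · simpa using hK _ (hC x)
  · have h := ContinuousLinearMap.hasDerivAt_det_id_add_smul (fderiv ℝ s x)
    have hpos : 0 < (ContinuousLinearMap.id ℝ E + (0 : ℝ) • fderiv ℝ s x).det := by
      simp [ContinuousLinearMap.det]
    exact ((hasDerivAt_abs_pos hpos).comp 0 h).congr_deriv (one_mul _)

/-- **Shape sensitivity of the quadratic volume penalty.**
For bounded measurable `Ω ⊆ ℝⁿ`, a `C¹` vector field `s` with bounded derivative, `γ₁ > 0`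
and target volume `V₀`, the functional `J_V(t) = γ₁ (vol(Φ_t(Ω)) − V₀)²` with
`Φ_t = id + t • s` is differentiable at `t = 0` with derivative
`2 γ₁ (vol(Ω) − V₀) ∫_Ω div s(x) dx`. -/
theorem volume_penalty_shape_derivative
    (n : ℕ) (hn : 1 ≤ n) (Ω : Set (EuclideanSpace ℝ (Fin n)))
    (hΩb : Bornology.IsBounded Ω) (hΩm : MeasurableSet Ω)
    (s : EuclideanSpace ℝ (Fin n) → EuclideanSpace ℝ (Fin n))
    (hs : ContDiff ℝ 1 s) (C : ℝ) (hC : ∀ x, ‖fderiv ℝ s x‖ ≤ C)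
    (γ₁ : ℝ) (hγ₁ : 0 < γ₁) (V₀ : ℝ) :
    HasDerivAt
      (fun t : ℝ => γ₁ * ((volume ((fun x => x + t • s x) '' Ω)).toReal - V₀) ^ 2)
      (2 * γ₁ * ((volume Ω).toReal - V₀) *
        ∫ x in Ω,
          LinearMap.trace ℝ (EuclideanSpace ℝ (Fin n)) (fderiv ℝ s x).toLinearMap) 0 := by
  have h := hasDerivAt_measureReal_image_id_add_smul volume hΩm hΩb.measure_lt_top.ne hs hC
  refine (((h.sub_const V₀).pow 2).const_mul γ₁).congr_deriv ?_
  simp [Measure.real]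
  ring
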